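/- Let C be a left-cancellative category and S a subfamily of its morphisms such that S♯ generates C and every morphism that is a composite of two elements of S♯ admits an S-normal decomposition. If a morphism g of C admits an S-normal decomposition of length q, then for every f ∈ S♯ such that fg is defined, the morphism fg admits an S-normal decomposition of length q + 1; moreover ‖g‖_S ≤ ‖fg‖_S ≤ ‖g‖_S + 1. -/

import Mathlib

open CategoryTheory

universe u v

namespace GarsideTest

variable {C : Type u} [Category.{v} C]

/-- `C` is left-cancellative. -/
def LeftCancellative (C : Type u) [Category.{v} C] : Prop :=
  ∀ ⦃x y z : C⦄ (f : x ⟶ y) (g g' : y ⟶ z), f ≫ g = f ≫ g' → g = g'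

/-- `f` left-divides `g`. -/
def LDiv {x y z : C} (f : x ⟶ y) (g : x ⟶ z) : Prop :=
  ∃ r : y ⟶ z, f ≫ r = g

/-- `f` properly left-divides `g` (`f ⊏ g`). -/
def LDivStrict {x y z : C} (f : x ⟶ y) (g : x ⟶ z) : Prop :=
  LDiv f g ∧ ¬ LDiv g f

/-- `f =× g` : `g` is obtained from `f` by right-multiplication by an invertible element. -/
def EqIr {x y z : C} (f : x ⟶ y) (g : x ⟶ z) : Prop :=
  ∃ e : y ⟶ z, IsIso e ∧ f ≫ e = g

/-- The family `S♯ = S C× ∪ C×`. -/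
def Sharp (S : MorphismProperty C) : MorphismProperty C :=
  fun x z g =>
    (∃ (y : C) (s : x ⟶ y) (e : y ⟶ z), S s ∧ IsIso e ∧ s ≫ e = g) ∨ IsIso g

/-- Composable paths of morphisms of `C`. -/
inductive Path {C : Type u} [Category.{v} C] : C → C → Type (max u v)
  | nil (x : C) : Path x x
  | cons {x y z : C} (g : x ⟶ y) (p : Path y z) : Path x z

namespace Path

/-- The composite of a path. -/
def comp : ∀ {x z : C}, Path x z → (x ⟶ z)
  | _, _, nil x => 𝟙 x
  | _, _, cons g p => g ≫ p.comp

/-- The length of a path. -/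
def length : ∀ {x z : C}, Path x z → ℕ
  | _, _, nil _ => 0
  | _, _, cons _ p => p.length + 1

/-- All entries of the path lie in `T`. -/
def Entries (T : MorphismProperty C) : ∀ {x z : C}, Path x z → Prop
  | _, _, nil _ => True
  | _, _, cons g p => T g ∧ Entries T p

/-- Concatenation of paths. -/
def append : ∀ {x y z : C}, Path x y → Path y z → Path x z
  | _, _, _, nil _, q => q
  | _, _, _, cons g p, q => cons g (p.append q)

open scoped Classical in
/-- Number of non-invertible entries of a path. -/
noncomputable def ninv : ∀ {x z : C}, Path x z → ℕ
  | _, _, nil _ => 0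
  | _, _, cons g p => (if IsIso g then 0 else 1) + p.ninv

end Path

/-- The length-two path `(g₁, g₂)` is `S`-greedy. -/
def Greedy2 (S : MorphismProperty C) {x y z : C} (g₁ : x ⟶ y) (g₂ : y ⟶ z) : Prop :=
  ∀ ⦃u w : C⦄ (f : u ⟶ x) (h : u ⟶ w), S h → LDiv h (f ≫ g₁ ≫ g₂) → LDiv h (f ≫ g₁)

/-- Auxiliary: the path `g :: p` is `S`-greedy. -/
def Path.GreedyFrom (S : MorphismProperty C) : ∀ {x y z : C}, (x ⟶ y) → Path y z → Prop
  | _, _, _, _, .nil _ => True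
  | _, _, _, g, .cons g' p => Greedy2 S g g' ∧ Path.GreedyFrom S g' p

/-- The path `p` is `S`-greedy. -/
def Path.Greedy (S : MorphismProperty C) : ∀ {x z : C}, Path x z → Prop
  | _, _, .nil _ => True
  | _, _, .cons g p => Path.GreedyFrom S g p

/-- The path `p` is `S`-normal: `S`-greedy with entries in `S♯`. -/
def Path.Normal (S : MorphismProperty C) {x z : C} (p : Path x z) : Prop :=
  p.Greedy S ∧ p.Entries (Sharp S)

/-- `p` is an `S`-normal decomposition of the morphism `g`. -/
def IsNormalDecomp (S : MorphismProperty C) {x z : C} (g : x ⟶ z) (p : Path x z) : Prop :=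
  p.Normal S ∧ p.comp = g

/-- `X` generates `C`. -/
def Generates (X : MorphismProperty C) : Prop :=
  ∀ ⦃x z : C⦄ (g : x ⟶ z), ∃ p : Path x z, p.Entries X ∧ p.comp = g

/-- `S` is a Garside family in `C`. -/
def IsGarside (S : MorphismProperty C) : Prop :=
  ∀ ⦃x z : C⦄ (g : x ⟶ z), ∃ p : Path x z, IsNormalDecomp S g p

/-- `Xʳ`: morphisms expressible as composites of `r` elements of `X`. -/
def MPow (X : MorphismProperty C) (r : ℕ) : MorphismProperty C :=
  fun x z g => ∃ p : Path x z, p.Entries X ∧ p.length = r ∧ p.comp = g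

/-- `X` is closed under right-complement. -/
def ClosedUnderRightComplement (X : MorphismProperty C) : Prop :=
  ∀ ⦃x y y' z : C⦄ (f : x ⟶ y) (g : x ⟶ y') (h : x ⟶ z), X f → X g →
    LDiv f h → LDiv g h →
    ∃ (w : C) (g' : y ⟶ w) (f' : y' ⟶ w),
      X g' ∧ X f' ∧ f ≫ g' = g ≫ f' ∧ LDiv (f ≫ g') h

/-- `X` is closed under right-comultiple. -/
def ClosedUnderRightComultiple (X : MorphismProperty C) : Prop :=
  ∀ ⦃x y y' z : C⦄ (f : x ⟶ y) (g : x ⟶ y') (h : x ⟶ z), X f → X g →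
    LDiv f h → LDiv g h →
    ∃ (w : C) (h' : x ⟶ w), X h' ∧ LDiv f h' ∧ LDiv g h' ∧ LDiv h' h

/-- `X` is closed under right-divisor. -/
def ClosedUnderRightDivisor (X : MorphismProperty C) : Prop :=
  ∀ ⦃x y z : C⦄ (f : x ⟶ y) (g : y ⟶ z), X (f ≫ g) → X g

/-- `g₁` is an `S`-head of `g`. -/
def IsHead (S : MorphismProperty C) {x w y : C} (g₁ : x ⟶ w) (g : x ⟶ y) : Prop :=
  S g₁ ∧ LDiv g₁ g ∧ ∀ ⦃w' : C⦄ (h : x ⟶ w'), S h → LDiv h g → LDiv h g₁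

/-- `h` is a right-lcm of `f` and `g`. -/
def IsRightLcm {x y y' w : C} (f : x ⟶ y) (g : x ⟶ y') (h : x ⟶ w) : Prop :=
  LDiv f h ∧ LDiv g h ∧ ∀ ⦃w' : C⦄ (h' : x ⟶ w'), LDiv f h' → LDiv g h' → LDiv h h'

/-- `X` is closed under right-lcm. -/
def ClosedUnderRightLcm (X : MorphismProperty C) : Prop :=
  ∀ ⦃x y y' w : C⦄ (f : x ⟶ y) (g : x ⟶ y') (h : x ⟶ w), X f → X g →
    IsRightLcm f g h → X h

/-- `C` is right-Noetherian: proper right-divisibility is well-founded. -/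
def RightNoetherian (C : Type u) [Category.{v} C] : Prop :=
  WellFounded (fun a b : Σ (x : C) (y : C), x ⟶ y =>
    ∃ (e : a.2.1 = b.2.1) (g' : b.1 ⟶ a.1), ¬ IsIso g' ∧ g' ≫ a.2.2 ≫ eqToHom e = b.2.2)

/-- `C` is left-Noetherian: proper left-divisibility is well-founded. -/
def LeftNoetherian (C : Type u) [Category.{v} C] : Prop :=
  WellFounded (fun a b : Σ (x : C) (y : C), x ⟶ y =>
    ∃ (e : b.1 = a.1) (g' : a.2.1 ⟶ b.2.1), ¬ IsIso g' ∧ eqToHom e ≫ a.2.2 ≫ g' = b.2.2)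

/-- `g` is an atom of `C`. -/
def IsAtomMor {x y : C} (g : x ⟶ y) : Prop :=
  ¬ IsIso g ∧ ∀ ⦃w : C⦄ (f : x ⟶ w) (h : w ⟶ y), f ≫ h = g → IsIso f ∨ IsIso h

/-- The only invertible morphisms of `C` are identities. -/
def NoNontrivialInvertible (C : Type u) [Category.{v} C] : Prop :=
  ∀ ⦃x y : C⦄ (e : x ⟶ y), IsIso e → ∃ h : x = y, e = eqToHom h

/-- Deformation by invertible elements, with a connecting morphism `e` at the left end. -/
inductive DeformRel : ∀ {xf xg z : C}, (xf ⟶ xg) → Path xf z → Path xg z → Prop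
  | nil (z : C) : DeformRel (𝟙 z) (.nil z) (.nil z)
  | cons {xf xg yf yg z : C} (e : xf ⟶ xg) (f : xf ⟶ yf) (g : xg ⟶ yg) (e' : yf ⟶ yg)
      {p : Path yf z} {q : Path yg z} :
      IsIso e' → e ≫ g = f ≫ e' → DeformRel e' p q →
      DeformRel e (.cons f p) (.cons g q)
  | padF {xg yg z : C} (e : z ⟶ xg) (g : xg ⟶ yg) (e' : z ⟶ yg) {q : Path yg z} :
      IsIso e' → e ≫ g = e' → DeformRel e' (.nil z) q →
      DeformRel e (.nil z) (.cons g q)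
  | padG {xf yf z : C} (e : xf ⟶ z) (f : xf ⟶ yf) (e' : yf ⟶ z) {p : Path yf z} :
      IsIso e' → e = f ≫ e' → DeformRel e' p (.nil z) →
      DeformRel e (.cons f p) (.nil z)

/-- `p` is a `C×`-deformation of `q`. -/
def IsDeformation {x z : C} (p q : Path x z) : Prop :=
  DeformRel (𝟙 x) p q

theorem LDiv.of_trans {x y z w : C} {f : x ⟶ y} {g : x ⟶ z} (h : LDiv f g) (r : z ⟶ w) :
    LDiv f (g ≫ r) := by
  obtain ⟨k, rfl⟩ := h
  exact ⟨k ≫ r, by simp⟩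

theorem Sharp.of_isIso (S : MorphismProperty C) {x y : C} (e : x ⟶ y) (he : IsIso e) :
    Sharp S e :=
  Or.inr he

theorem Sharp.comp_isIso {S : MorphismProperty C} {x y z : C} {g : x ⟶ y} (hg : Sharp S g)
    (e : y ⟶ z) (he : IsIso e) : Sharp S (g ≫ e) := by
  rcases hg with ⟨w, s, e', hs, he', rfl⟩ | hg
  · exact Or.inl ⟨w, s, e' ≫ e, hs, inferInstance, by simp⟩
  · exact Or.inr inferInstance

/-- Greediness with respect to `S` implies greediness with respect to `S♯`. -/
theorem Greedy2.ldiv_of_sharp {S : MorphismProperty C} {x y z u w : C} {g₁ : x ⟶ y} {g₂ : y ⟶ z}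
    (hg : Greedy2 S g₁ g₂) (f : u ⟶ x) (h : u ⟶ w) (hh : Sharp S h)
    (hd : LDiv h (f ≫ g₁ ≫ g₂)) : LDiv h (f ≫ g₁) := by
  rcases hh with ⟨v, s, e, hs, he, rfl⟩ | hh
  · obtain ⟨r, hr⟩ := hd
    obtain ⟨k, hk⟩ := hg f s hs ⟨e ≫ r, by simpa using hr⟩
    exact ⟨inv e ≫ k, by simpa using hk⟩
  · exact ⟨inv h ≫ f ≫ g₁, by simp⟩

theorem Greedy2.of_comp {S : MorphismProperty C} {x y z w : C} {g₁ : x ⟶ y} {g₂ : y ⟶ z}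
    {g₃ : z ⟶ w} (hg : Greedy2 S g₁ (g₂ ≫ g₃)) : Greedy2 S g₁ g₂ := fun _ _ f h hh hd =>
  hg f h hh (by simpa using hd.of_trans g₃)

theorem Greedy2.comp {S : MorphismProperty C} {x y z w : C} {g₁ : x ⟶ y} {g₂ : y ⟶ z}
    {g₃ : z ⟶ w} (h₁₂ : Greedy2 S g₁ g₂) (h₂₃ : Greedy2 S g₂ g₃) : Greedy2 S g₁ (g₂ ≫ g₃) :=
  fun _ _ f h hh hd =>
    h₁₂ f h hh (by simpa using h₂₃ (f ≫ g₁) h hh (by simpa using hd))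

theorem Greedy2.of_id (S : MorphismProperty C) {x y : C} (g : x ⟶ y) : Greedy2 S g (𝟙 y) :=
  fun _ _ _ _ _ hd => by simpa using hd

theorem Path.greedyFrom_iff {S : MorphismProperty C} {y z : C} (p : Path y z) :
    ∀ {x : C} (g : x ⟶ y), Path.GreedyFrom S g p ↔ Greedy2 S g p.comp ∧ p.Greedy S := by
  induction p with
  | nil y => exact fun g => ⟨fun _ => ⟨Greedy2.of_id S g, trivial⟩, fun _ => trivial⟩
  | cons b p ih =>
    intro x g
    constructor
    · rintro ⟨h, hp⟩
      exact ⟨h.comp ((ih b).1 hp).1, hp⟩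
    · rintro ⟨h, hp⟩
      exact ⟨Greedy2.of_comp h, hp⟩

theorem Path.normal_cons_iff {S : MorphismProperty C} {x y z : C} (g : x ⟶ y) (p : Path y z) :
    (Path.cons g p).Normal S ↔ Sharp S g ∧ Greedy2 S g p.comp ∧ p.Normal S := by
  have h := Path.greedyFrom_iff (S := S) p g
  constructor
  · rintro ⟨hg, hs, hp⟩
    exact ⟨hs, (h.1 hg).1, (h.1 hg).2, hp⟩
  · rintro ⟨hs, hg, hp, he⟩
    exact ⟨h.2 ⟨hg, hp⟩, hs, he⟩

theorem Path.normal_nil (S : MorphismProperty C) (x : C) : (Path.nil x).Normal S :=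
  ⟨trivial, trivial⟩

namespace LeftCancellative

theorem isIso_right (hC : LeftCancellative C) {x y : C} {f : x ⟶ y} {g : y ⟶ x}
    (h : f ≫ g = 𝟙 x) : IsIso g :=
  ⟨f, hC f _ _ (by rw [reassoc_of% h, Category.comp_id]), h⟩

theorem isIso_left (hC : LeftCancellative C) {x y : C} {f : x ⟶ y} {g : y ⟶ x}
    (h : f ≫ g = 𝟙 x) : IsIso f :=
  ⟨g, h, hC f _ _ (by rw [reassoc_of% h, Category.comp_id])⟩

theorem isIso_of_comp (hC : LeftCancellative C) {x y z : C} {f : x ⟶ y} {g : y ⟶ z}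
    (h : IsIso (f ≫ g)) : IsIso f ∧ IsIso g := by
  have hf : IsIso f := hC.isIso_left (g := g ≫ inv (f ≫ g)) (by
    rw [← Category.assoc, IsIso.hom_inv_id])
  exact ⟨hf, IsIso.of_isIso_comp_left f g⟩

theorem ninv_eq_zero (hC : LeftCancellative C) {x y : C} (p : Path x y) (h : IsIso p.comp) :
    p.ninv = 0 := by
  induction p with
  | nil => rfl
  | cons g p ih =>
    obtain ⟨hg, hp⟩ := hC.isIso_of_comp h
    simp [Path.ninv, hg, ih hp]

/-- A normal path has at most as many non-invertible entries as any path with entries in `S♯`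
whose composite is a left multiple of its own. -/
theorem ninv_le_of_comp_eq (hC : LeftCancellative C) {S : MorphismProperty C} {x z : C}
    (d : Path x z) (hd : d.Entries (Sharp S)) :
    ∀ {y : C} (t : x ⟶ y) (p : Path y z), p.Normal S → t ≫ p.comp = d.comp →
      p.ninv ≤ d.ninv := by
  induction d with
  | nil x =>
    intro y t p _ h
    exact (hC.ninv_eq_zero p (hC.isIso_right h)).le
  | cons s d ih =>
    intro y t p hp h
    by_cases hs : IsIso s
    · refine (ih hd.2 (inv s ≫ t) p hp ?_).trans (Nat.le_add_left _ _)
      simpa [Path.comp] using congrArg (inv s ≫ ·) h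
    · cases p with
      | nil => exact Nat.zero_le _
      | cons g p =>
        obtain ⟨-, hg, hp⟩ := (Path.normal_cons_iff g p).1 hp
        obtain ⟨r, hr⟩ := hg.ldiv_of_sharp t s hd.1 ⟨d.comp, h.symm⟩
        have hle := ih hd.2 r p hp (hC s _ _ (by
          rw [reassoc_of% hr]
          exact h))
        simp only [Path.ninv, hs, if_false]
        split_ifs <;> omega

/-- The composite of a normal path that right-divides an element of `S♯` lies in `S♯`. -/
theorem sharp_comp (hC : LeftCancellative C) {S : MorphismProperty C} {x y z : C}
    (t : x ⟶ y) (p : Path y z) (hp : p.Normal S) (h : Sharp S (t ≫ p.comp)) :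
    Sharp S p.comp := by
  cases p with
  | nil => exact Sharp.of_isIso S _ (inferInstanceAs (IsIso (𝟙 _)))
  | cons b p =>
    obtain ⟨hb, hg, -⟩ := (Path.normal_cons_iff b p).1 hp
    obtain ⟨r, hr⟩ := hg.ldiv_of_sharp t _ h ⟨𝟙 z, Category.comp_id _⟩
    refine hb.comp_isIso _ (hC.isIso_right (f := r) (hC (t ≫ b ≫ p.comp) _ _ ?_))
    rw [Category.comp_id, ← Category.assoc]
    exact (congrArg (· ≫ p.comp) hr).trans (by simp)

theorem exists_greedy2 (hC : LeftCancellative C) {S : MorphismProperty C} {x y z : C}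
    {f : x ⟶ y} {s : y ⟶ z} (hf : Sharp S f) (hs : Sharp S s) (p : Path x z)
    (hp : IsNormalDecomp S (f ≫ s) p) :
    ∃ (w : C) (s' : x ⟶ w) (t : w ⟶ z),
      Sharp S s' ∧ Sharp S t ∧ Greedy2 S s' t ∧ s' ≫ t = f ≫ s := by
  obtain ⟨hp, hc⟩ := hp
  cases p with
  | nil =>
    exact ⟨_, 𝟙 _, 𝟙 _, Sharp.of_isIso S _ inferInstance, Sharp.of_isIso S _ inferInstance,
      Greedy2.of_id S _, by simpa [Path.comp] using hc⟩
  | cons a p =>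
    obtain ⟨ha, hg, hp⟩ := (Path.normal_cons_iff a p).1 hp
    obtain ⟨r, hr⟩ := hg.ldiv_of_sharp (𝟙 x) f hf ⟨s, by simpa [Path.comp] using hc.symm⟩
    have h : r ≫ p.comp = s := hC f _ _ (by
      rw [reassoc_of% hr]
      exact hc)
    exact ⟨_, a, p.comp, ha, hC.sharp_comp r p hp (h ▸ hs), hg, hc⟩

theorem exists_normal_comp (hC : LeftCancellative C) {S : MorphismProperty C}
    (h2 : ∀ ⦃x z : C⦄ (g : x ⟶ z), MPow (Sharp S) 2 g → ∃ p : Path x z, IsNormalDecomp S g p)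
    {y z : C} (p : Path y z) (hp : p.Normal S) :
    ∀ {x : C} (f : x ⟶ y), Sharp S f →
      ∃ p' : Path x z, IsNormalDecomp S (f ≫ p.comp) p' ∧ p'.length = p.length + 1 := by
  induction p with
  | nil y =>
    exact fun f hf => ⟨.cons f (.nil y),
      ⟨(Path.normal_cons_iff _ _).2 ⟨hf, Greedy2.of_id S f, Path.normal_nil S y⟩, rfl⟩, rfl⟩
  | cons s p ih =>
    intro x f hf
    obtain ⟨hs, hg, hp⟩ := (Path.normal_cons_iff s p).1 hp
    obtain ⟨d, hd⟩ := h2 (f ≫ s)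
      ⟨.cons f (.cons s (.nil _)), ⟨hf, hs, trivial⟩, rfl, by simp [Path.comp]⟩
    obtain ⟨w, s', t, hs', ht, hst, heq⟩ := hC.exists_greedy2 hf hs d hd
    obtain ⟨p', ⟨hp', hc⟩, hl⟩ := ih hp t ht
    refine ⟨.cons s' p', ⟨(Path.normal_cons_iff _ _).2 ⟨hs', ?_, hp'⟩, ?_⟩, ?_⟩
    · intro u v k h hh hdiv
      refine hst k h hh ?_
      rw [hc, reassoc_of% heq] at hdiv
      rw [heq]
      simpa using hg (k ≫ f) h hh (by simpa using hdiv)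
    · simp only [Path.comp, hc]
      rw [reassoc_of% heq]
    · simp [Path.length, hl]

end LeftCancellative

theorem stmt8 {C : Type u} [Category.{v} C] (hC : LeftCancellative C)
    (S : MorphismProperty C) (hgen : Generates (Sharp S))
    (h2 : ∀ ⦃x z : C⦄ (g : x ⟶ z), MPow (Sharp S) 2 g → ∃ p : Path x z, IsNormalDecomp S g p)
    {x y z : C} (g : y ⟶ z) (q : ℕ) (p : Path y z)
    (hp : IsNormalDecomp S g p) (hlen : p.length = q)
    (f : x ⟶ y) (hf : Sharp S f) :
    (∃ p' : Path x z, IsNormalDecomp S (f ≫ g) p' ∧ p'.length = q + 1) ∧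
    (∀ (p₁ : Path y z) (p₂ : Path x z), IsNormalDecomp S g p₁ →
      IsNormalDecomp S (f ≫ g) p₂ → p₁.ninv ≤ p₂.ninv ∧ p₂.ninv ≤ p₁.ninv + 1) := by
  obtain ⟨hn, rfl⟩ := hp
  subst hlen
  refine ⟨hC.exists_normal_comp h2 p hn f hf, fun p₁ p₂ h₁ h₂ => ⟨?_, ?_⟩⟩
  · exact hC.ninv_le_of_comp_eq p₂ h₂.1.2 f p₁ h₁.1 (by rw [h₁.2, h₂.2])
  · refine (hC.ninv_le_of_comp_eq (.cons f p₁) ⟨hf, h₁.1.2⟩ (𝟙 x) p₂ h₂.1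
      (by rw [Category.id_comp, h₂.2, Path.comp, h₁.2])).trans ?_
    simp only [Path.ninv]
    split_ifs <;> omega

end GarsideTest
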